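/- Let m > 0, ν ∈ (0, 1/m], λ ≤ 0, and let c > 0 satisfy (1 − 2λ)·J_ν(2c/m) + 2c·J′_ν(2c/m) = 0 with 2c/m ∈ (0, j_ν). Let f be an absolutely continuous function on [0, 1] with f(0) = 0 and f′(x)/x ∈ L¹[0, 1]. Then ((1 − ν²m²)/4)·∫₀¹ |f(x)|/x² dx + c²·∫₀¹ |f(x)|/x^{2−m} dx ≤ ∫₀¹ (|f′(x)|/x)·((1 + νm)/2 − λx) dx. -/

import Mathlib

open MeasureTheory Real Set Filter

/-- Bessel function of the first kind of real order `ν`, defined for `x > 0` by its series. -/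
noncomputable def besselJ (ν x : ℝ) : ℝ :=
  ∑' k : ℕ, (-1 : ℝ) ^ k * x ^ (2 * (k : ℝ) + ν) /
    (2 ^ (2 * (k : ℝ) + ν) * (Nat.factorial k : ℝ) * Real.Gamma ((k : ℝ) + 1 + ν))


/-- The entire function `∑ (-s)^k / (k! Γ(k+1+ν))`, related to the Bessel function by
`J_ν(x) = (x/2)^ν φ_ν(x²/4)`. -/
noncomputable def besselEntire (ν s : ℝ) : ℝ :=
  ∑' k : ℕ, (-1 : ℝ) ^ k * s ^ k / ((Nat.factorial k : ℝ) * Real.Gamma ((k : ℝ) + 1 + ν))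

lemma Gamma_one_add_le_Gamma_nat_add {ν : ℝ} (hν : 0 < ν) (k : ℕ) :
    Real.Gamma (1 + ν) ≤ Real.Gamma ((k : ℝ) + 1 + ν) := by
  induction k with
  | zero => simp
  | succ k ih =>
    have hk : (0 : ℝ) ≤ k := Nat.cast_nonneg k
    have hG : 0 < Real.Gamma ((k : ℝ) + 1 + ν) := Real.Gamma_pos_of_pos (by linarith)
    have h : Real.Gamma (((k + 1 : ℕ) : ℝ) + 1 + ν)
        = ((k : ℝ) + 1 + ν) * Real.Gamma ((k : ℝ) + 1 + ν) := by
      rw [← Real.Gamma_add_one (by linarith)]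
      push_cast
      ring_nf
    rw [h]
    nlinarith

lemma abs_besselEntire_term_le {ν : ℝ} (hν : 0 < ν) {s r : ℝ} (hs : |s| ≤ r) (k : ℕ) :
    |(-1 : ℝ) ^ k * s ^ k / ((Nat.factorial k : ℝ) * Real.Gamma ((k : ℝ) + 1 + ν))|
      ≤ (Real.Gamma (1 + ν))⁻¹ * (r ^ k / (Nat.factorial k : ℝ)) := by
  have hG1 : 0 < Real.Gamma (1 + ν) := Real.Gamma_pos_of_pos (by linarith)
  have hG := Gamma_one_add_le_Gamma_nat_add hν k
  have hf : (0 : ℝ) < Nat.factorial k := by positivity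
  rw [abs_div, abs_mul, abs_pow, abs_pow, abs_neg, abs_one, one_pow, one_mul,
    abs_of_pos (mul_pos hf (hG1.trans_le hG))]
  calc |s| ^ k / ((Nat.factorial k : ℝ) * Real.Gamma ((k : ℝ) + 1 + ν))
      ≤ r ^ k / ((Nat.factorial k : ℝ) * Real.Gamma (1 + ν)) := by
        have := (abs_nonneg s).trans hs
        gcongr
    _ = _ := by field_simp

lemma summable_besselEntire {ν : ℝ} (hν : 0 < ν) (s : ℝ) :
    Summable fun k : ℕ =>
      (-1 : ℝ) ^ k * s ^ k / ((Nat.factorial k : ℝ) * Real.Gamma ((k : ℝ) + 1 + ν)) :=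
  Summable.of_norm_bounded ((Real.summable_pow_div_factorial |s|).mul_left _)
    fun k => abs_besselEntire_term_le hν le_rfl k

lemma besselEntire_deriv_term (ν s : ℝ) (k : ℕ) :
    (-1 : ℝ) ^ (k + 1) * (((k + 1 : ℕ) : ℝ) * s ^ k)
        / ((Nat.factorial (k + 1) : ℝ) * Real.Gamma (((k + 1 : ℕ) : ℝ) + 1 + ν))
      = -((-1 : ℝ) ^ k * s ^ k
        / ((Nat.factorial k : ℝ) * Real.Gamma ((k : ℝ) + 1 + (ν + 1)))) := by
  have hk : ((k + 1 : ℕ) : ℝ) ≠ 0 := by positivity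
  have hf : (Nat.factorial k : ℝ) ≠ 0 := by positivity
  have hG : ((k + 1 : ℕ) : ℝ) + 1 + ν = (k : ℝ) + 1 + (ν + 1) := by push_cast; ring
  rw [hG, Nat.factorial_succ, Nat.cast_mul, pow_succ, mul_assoc ((k + 1 : ℕ) : ℝ), ← neg_div,
    show (-1 : ℝ) ^ k * -1 * (((k + 1 : ℕ) : ℝ) * s ^ k)
      = ((k + 1 : ℕ) : ℝ) * -((-1) ^ k * s ^ k) by ring, mul_div_mul_left _ _ hk]

lemma hasDerivAt_besselEntire {ν : ℝ} (hν : 0 < ν) (s : ℝ) :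
    HasDerivAt (besselEntire ν) (-besselEntire (ν + 1) s) s := by
  let r : ℝ := |s| + 1
  have hν1 : 0 < ν + 1 := by linarith
  let u : ℕ → ℝ := fun k => Nat.casesOn k 0
    fun j => (Real.Gamma (1 + (ν + 1)))⁻¹ * (r ^ j / (Nat.factorial j : ℝ))
  have hu : Summable u :=
    (summable_nat_add_iff 1).1 ((Real.summable_pow_div_factorial r).mul_left _)
  have hs : s ∈ Ioo (-r) r := abs_lt.1 (lt_add_one _)
  have key := hasDerivAt_tsum_of_isPreconnected (𝕜 := ℝ) (t := Ioo (-r) r) (y₀ := s) (y := s)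
    (g := fun k s => (-1 : ℝ) ^ k * s ^ k
      / ((Nat.factorial k : ℝ) * Real.Gamma ((k : ℝ) + 1 + ν)))
    (g' := fun k s => (-1 : ℝ) ^ k * ((k : ℝ) * s ^ (k - 1))
      / ((Nat.factorial k : ℝ) * Real.Gamma ((k : ℝ) + 1 + ν)))
    hu isOpen_Ioo isPreconnected_Ioo
    (fun k y _ => ((hasDerivAt_pow k y).const_mul _).div_const _)
    (fun k y hy => by
      cases k with
      | zero => simp [u]
      | succ k =>
        rw [Nat.add_sub_cancel, besselEntire_deriv_term, norm_neg]
        exact abs_besselEntire_term_le hν1 (abs_lt.2 hy).le k)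
    hs (summable_besselEntire hν s) hs
  refine key.congr_deriv ?_
  have hsum : HasSum (fun k : ℕ => (-1 : ℝ) ^ (k + 1) * (((k + 1 : ℕ) : ℝ) * s ^ (k + 1 - 1))
      / ((Nat.factorial (k + 1) : ℝ) * Real.Gamma (((k + 1 : ℕ) : ℝ) + 1 + ν)))
      (-besselEntire (ν + 1) s) := by
    simp only [Nat.add_sub_cancel, besselEntire_deriv_term]
    exact (summable_besselEntire hν1 s).hasSum.neg
  have := (hasSum_nat_add_iff (f := fun k : ℕ => (-1 : ℝ) ^ k * ((k : ℝ) * s ^ (k - 1))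
      / ((Nat.factorial k : ℝ) * Real.Gamma ((k : ℝ) + 1 + ν))) 1).1 hsum
  simpa using this.tsum_eq

lemma besselEntire_recurrence {ν : ℝ} (hν : 0 < ν) (s : ℝ) :
    besselEntire ν s
      = (ν + 1) * besselEntire (ν + 1) s - s * besselEntire (ν + 1 + 1) s := by
  have h1 := (summable_besselEntire (ν := ν + 1) (by linarith) s).hasSum.mul_left (ν + 1)
  have h2 := (summable_besselEntire (ν := ν + 1 + 1) (by linarith) s).hasSum.mul_left (-s)
  have hshift : ∀ k : ℕ, -s * ((-1 : ℝ) ^ k * s ^ k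
        / ((Nat.factorial k : ℝ) * Real.Gamma ((k : ℝ) + 1 + (ν + 1 + 1))))
      = ((k + 1 : ℕ) : ℝ) * ((-1 : ℝ) ^ (k + 1) * s ^ (k + 1)
        / ((Nat.factorial (k + 1) : ℝ) * Real.Gamma (((k + 1 : ℕ) : ℝ) + 1 + (ν + 1)))) := by
    intro k
    have hk : ((k + 1 : ℕ) : ℝ) ≠ 0 := by positivity
    have hf : (Nat.factorial k : ℝ) ≠ 0 := by positivity
    have hG : ((k + 1 : ℕ) : ℝ) + 1 + (ν + 1) = (k : ℝ) + 1 + (ν + 1 + 1) := by push_cast; ring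
    have hG0 : Real.Gamma ((k : ℝ) + 1 + (ν + 1 + 1)) ≠ 0 :=
      (Real.Gamma_pos_of_pos (by positivity)).ne'
    rw [hG, Nat.factorial_succ, Nat.cast_mul]
    field_simp
    ring
  have hadd : ∀ k : ℕ, (ν + 1) * ((-1 : ℝ) ^ k * s ^ k
        / ((Nat.factorial k : ℝ) * Real.Gamma ((k : ℝ) + 1 + (ν + 1))))
      + (k : ℝ) * ((-1 : ℝ) ^ k * s ^ k
        / ((Nat.factorial k : ℝ) * Real.Gamma ((k : ℝ) + 1 + (ν + 1))))
      = (-1 : ℝ) ^ k * s ^ k / ((Nat.factorial k : ℝ) * Real.Gamma ((k : ℝ) + 1 + ν)) := by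
    intro k
    have hk0 : 0 < (k : ℝ) + 1 + ν := by positivity
    have hG : Real.Gamma ((k : ℝ) + 1 + (ν + 1))
        = ((k : ℝ) + 1 + ν) * Real.Gamma ((k : ℝ) + 1 + ν) := by
      rw [← Real.Gamma_add_one hk0.ne']
      ring_nf
    have hG0 : Real.Gamma ((k : ℝ) + 1 + ν) ≠ 0 := (Real.Gamma_pos_of_pos hk0).ne'
    have hf : (Nat.factorial k : ℝ) ≠ 0 := by positivity
    rw [hG]
    field_simp
    ring
  simp only [hshift] at h2
  have h3 := h1.add ((hasSum_nat_add_iff (f := fun k : ℕ => (k : ℝ) * ((-1 : ℝ) ^ k * s ^ k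
      / ((Nat.factorial k : ℝ) * Real.Gamma ((k : ℝ) + 1 + (ν + 1))))) 1).1 h2)
  simp only [hadd] at h3
  rw [besselEntire, h3.tsum_eq]
  simp [besselEntire]
  ring

lemma besselJ_eq {ν x : ℝ} (hx : 0 < x) :
    besselJ ν x = (x / 2) ^ ν * besselEntire ν (x ^ 2 / 4) := by
  rw [besselJ, besselEntire, ← tsum_mul_left]
  refine tsum_congr fun k => ?_
  have h2 : ∀ y : ℝ, 0 < y → y ^ (2 * (k : ℝ) + ν) = (y ^ 2) ^ k * y ^ ν := by
    intro y hy
    rw [Real.rpow_add hy, Real.rpow_mul hy.le, Real.rpow_natCast]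
    norm_num
  rw [h2 x hx, h2 2 two_pos, Real.div_rpow hx.le zero_le_two, div_pow]
  norm_num
  ring

lemma hasDerivAt_besselJ {ν x : ℝ} (hν : 0 < ν) (hx : 0 < x) :
    HasDerivAt (besselJ ν) ((x / 2) ^ ν * (ν / x * besselEntire ν (x ^ 2 / 4)
      - x / 2 * besselEntire (ν + 1) (x ^ 2 / 4))) x := by
  have h1 : HasDerivAt (fun y : ℝ => (y / 2) ^ ν) (1 / 2 * ν * (x / 2) ^ (ν - 1)) x :=
    ((hasDerivAt_id x).div_const 2).rpow_const (Or.inl (by simp; positivity))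
  have h2 : HasDerivAt (fun y : ℝ => y ^ 2 / 4) (x / 2) x :=
    ((hasDerivAt_pow 2 x).div_const 4).congr_deriv (by norm_num; ring)
  have h3 := h1.mul ((hasDerivAt_besselEntire hν (x ^ 2 / 4)).comp x h2)
  refine (h3.congr_of_eventuallyEq ?_).congr_deriv ?_
  · filter_upwards [lt_mem_nhds hx] with y hy
    exact besselJ_eq hy
  · rw [Real.rpow_sub_one (by positivity)]
    simp only [Function.comp]
    field_simp
    ring

/-- If `φ_ν` is positive on `(0, S)`, then so is `φ_{ν+1}`, up to equality. -/
lemma besselEntire_add_one_nonneg {ν S s : ℝ} (hν : 0 < ν)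
    (hpos : ∀ t ∈ Ioo 0 S, 0 < besselEntire ν t) (hs : s ∈ Ioo 0 S) :
    0 ≤ besselEntire (ν + 1) s := by
  have hderiv : ∀ t ∈ Ioo 0 S, HasDerivAt (fun y => y ^ (ν + 1) * besselEntire (ν + 1) y)
      (t ^ ν * besselEntire ν t) t := by
    intro t ht
    have h := (Real.hasDerivAt_rpow_const (x := t) (p := ν + 1) (Or.inl ht.1.ne')).mul
      (hasDerivAt_besselEntire (ν := ν + 1) (by linarith) t)
    refine h.congr_deriv ?_
    rw [besselEntire_recurrence hν t, Real.rpow_add_one ht.1.ne', add_sub_cancel_right]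
    ring
  have hcont : ContinuousOn (fun y => y ^ (ν + 1) * besselEntire (ν + 1) y) (Icc 0 s) :=
    ((Real.continuous_rpow_const (by linarith)).mul (continuous_iff_continuousAt.2 fun y =>
      (hasDerivAt_besselEntire (ν := ν + 1) (by linarith) y).continuousAt)).continuousOn
  have hsub : interior (Icc 0 s) ⊆ Ioo 0 S := by
    rw [interior_Icc]
    exact Ioo_subset_Ioo_right hs.2.le
  have hmono := monotoneOn_of_hasDerivWithinAt_nonneg (convex_Icc 0 s) hcont
    (fun t ht => (hderiv t (hsub ht)).hasDerivWithinAt)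
    (fun t ht => mul_nonneg (Real.rpow_nonneg (hsub ht).1.le _) (hpos t (hsub ht)).le)
  have h0 := hmono (left_mem_Icc.2 hs.1.le) (right_mem_Icc.2 hs.1.le) hs.1.le
  simp only [Real.zero_rpow (by linarith : ν + 1 ≠ 0), zero_mul] at h0
  exact nonneg_of_mul_nonneg_right h0 (Real.rpow_pos_of_pos hs.1 _)

/-- The Riccati equation for the logarithmic derivative of `t ↦ t^((1+νm)/2) φ_ν(a t^m)`. -/
lemma hasDerivAt_riccati {m ν a t : ℝ} (hν : 0 < ν) (ht : 0 < t)
    (hpos : besselEntire ν (a * t ^ m) ≠ 0) :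
    HasDerivAt (fun y => ((1 + ν * m) / 2 - m * (a * y ^ m * besselEntire (ν + 1) (a * y ^ m)
        / besselEntire ν (a * y ^ m))) / y)
      (-((1 - ν ^ 2 * m ^ 2) / 4 / t ^ 2 + m ^ 2 * a * t ^ m / t ^ 2)
        - (((1 + ν * m) / 2 - m * (a * t ^ m * besselEntire (ν + 1) (a * t ^ m)
        / besselEntire ν (a * t ^ m))) / t) ^ 2) t := by
  have hs : HasDerivAt (fun y : ℝ => a * y ^ m) (a * (m * t ^ (m - 1))) t :=
    (Real.hasDerivAt_rpow_const (Or.inl ht.ne')).const_mul a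
  have h0 := (hasDerivAt_besselEntire hν (a * t ^ m)).comp t hs
  have h1 := (hasDerivAt_besselEntire (ν := ν + 1) (by linarith) (a * t ^ m)).comp t hs
  have h := ((((hs.mul h1).div h0 hpos).const_mul m).const_sub ((1 + ν * m) / 2)).div
    (hasDerivAt_id t) ht.ne'
  refine h.congr_deriv ?_
  have hrec := besselEntire_recurrence hν (a * t ^ m)
  simp only [Function.comp, id, Pi.mul_apply, Real.rpow_sub_one ht.ne', Pi.div_apply]
  generalize t ^ m = T at *
  generalize besselEntire ν (a * T) = X at *
  generalize besselEntire (ν + 1) (a * T) = Y at *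
  generalize besselEntire (ν + 1 + 1) (a * T) = Z at *
  have hZ : a * T * Z = (ν + 1) * Y - X := by linarith
  field_simp
  linear_combination 16 * m ^ 2 * a * T * X * hZ

lemma continuousOn_of_eq_primitive {f f' : ℝ → ℝ} (hf'int : IntegrableOn f' (Icc 0 1))
    (hf : ∀ x ∈ Icc (0 : ℝ) 1, f x = ∫ t in (0 : ℝ)..x, f' t) : ContinuousOn f (Ioc 0 1) := by
  rw [← uIcc_of_le zero_le_one] at hf'int hf
  exact ((intervalIntegral.continuousOn_primitive_interval hf'int).congr hf).mono
    (uIcc_of_le (zero_le_one' ℝ) ▸ Ioc_subset_Icc_self)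

/-- Weighted Hardy-type inequality in `L¹`: a primitive integrated against `g` is controlled by the
derivative integrated against any majorant of the tail integrals of `g`. -/
lemma integral_abs_primitive_mul_le {f f' g h : ℝ → ℝ}
    (hf'int : IntegrableOn f' (Icc 0 1))
    (hf : ∀ x ∈ Icc (0 : ℝ) 1, f x = ∫ t in (0 : ℝ)..x, f' t)
    (hg : ContinuousOn g (Ioc 0 1)) (hg0 : ∀ x ∈ Ioc (0 : ℝ) 1, 0 ≤ g x)
    (hh0 : ∀ t ∈ Ioc (0 : ℝ) 1, 0 ≤ h t)
    (hgh : ∀ t ∈ Ioc (0 : ℝ) 1, ∫ x in t..1, g x ≤ h t)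
    (hint : IntegrableOn (fun t => |f' t| * h t) (Ioc 0 1)) :
    IntegrableOn (fun x => |f x| * g x) (Ioc 0 1) ∧
      ∫ x in Ioc (0 : ℝ) 1, |f x| * g x ≤ ∫ t in Ioc (0 : ℝ) 1, |f' t| * h t := by
  have hf'Ioc : IntegrableOn f' (Ioc 0 1) := hf'int.mono_set Ioc_subset_Icc_self
  have hfc : ContinuousOn f (Ioc 0 1) :=
    continuousOn_of_eq_primitive hf'int hf
  have hmeas : AEStronglyMeasurable (fun x => |f x| * g x) (volume.restrict (Ioc 0 1)) :=
    (hfc.abs.mul hg).aestronglyMeasurable measurableSet_Ioc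
  have hnn : 0 ≤ᵐ[volume.restrict (Ioc (0 : ℝ) 1)] fun x => |f x| * g x :=
    (ae_restrict_iff' measurableSet_Ioc).2 (ae_of_all _ fun x hx =>
      mul_nonneg (abs_nonneg _) (hg0 x hx))
  have hnn' : 0 ≤ᵐ[volume.restrict (Ioc (0 : ℝ) 1)] fun t => |f' t| * h t :=
    (ae_restrict_iff' measurableSet_Ioc).2 (ae_of_all _ fun t ht =>
      mul_nonneg (abs_nonneg _) (hh0 t ht))
  have hpoint : ∀ x ∈ Ioc (0 : ℝ) 1, ENNReal.ofReal (|f x| * g x)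
      ≤ ∫⁻ t in Ioc (0 : ℝ) 1, (Ici t).indicator
        (fun x => ENNReal.ofReal |f' t| * ENNReal.ofReal (g x)) x := by
    intro x hx
    have h1 : |f x| ≤ ∫ t in Ioc 0 x, |f' t| := by
      rw [hf x ⟨hx.1.le, hx.2⟩, ← intervalIntegral.integral_of_le hx.1.le]
      exact intervalIntegral.abs_integral_le_integral_abs hx.1.le
    have hsub : Ioc 0 x ⊆ Ioc (0 : ℝ) 1 := Ioc_subset_Ioc_right hx.2
    calc ENNReal.ofReal (|f x| * g x)
        = ENNReal.ofReal |f x| * ENNReal.ofReal (g x) := ENNReal.ofReal_mul (abs_nonneg _)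
      _ ≤ (∫⁻ t in Ioc 0 x, ENNReal.ofReal |f' t|) * ENNReal.ofReal (g x) := by
          rw [← ofReal_integral_eq_lintegral_ofReal (hf'Ioc.mono_set hsub).abs
            (ae_of_all _ fun _ => abs_nonneg _)]
          gcongr
      _ = ∫⁻ t in Ioc 0 x, ENNReal.ofReal |f' t| * ENNReal.ofReal (g x) :=
          (lintegral_mul_const' _ _ ENNReal.ofReal_ne_top).symm
      _ = ∫⁻ t in Ioc 0 x, (Ici t).indicator
            (fun x => ENNReal.ofReal |f' t| * ENNReal.ofReal (g x)) x :=
          setLIntegral_congr_fun measurableSet_Ioc fun t ht => by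
            simp [indicator_of_mem (show x ∈ Ici t from ht.2)]
      _ ≤ _ := lintegral_mono_set hsub
  have htail : ∀ t ∈ Ioc (0 : ℝ) 1, ∫⁻ x in Ioc (0 : ℝ) 1, (Ici t).indicator
        (fun x => ENNReal.ofReal |f' t| * ENNReal.ofReal (g x)) x
      ≤ ENNReal.ofReal (|f' t| * h t) := by
    intro t ht
    have hsub : Icc t 1 ⊆ Ioc (0 : ℝ) 1 := fun x hx => ⟨ht.1.trans_le hx.1, hx.2⟩
    have hset : Ici t ∩ Ioc (0 : ℝ) 1 = Icc t 1 := by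
      ext x
      exact ⟨fun hx => ⟨hx.1, hx.2.2⟩, fun hx => ⟨hx.1, hsub hx⟩⟩
    rw [lintegral_indicator measurableSet_Ici, Measure.restrict_restrict measurableSet_Ici, hset,
      lintegral_const_mul' _ _ ENNReal.ofReal_ne_top, ENNReal.ofReal_mul (abs_nonneg _),
      ← ofReal_integral_eq_lintegral_ofReal ((hg.mono hsub).integrableOn_Icc)
        ((ae_restrict_iff' measurableSet_Icc).2 (ae_of_all _ fun x hx => hg0 x (hsub hx))),
      integral_Icc_eq_integral_Ioc, ← intervalIntegral.integral_of_le ht.2]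
    gcongr
    exact hgh t ht
  have hswapmeas : AEMeasurable (Function.uncurry fun x t : ℝ => (Ici t).indicator
        (fun x => ENNReal.ofReal |f' t| * ENNReal.ofReal (g x)) x)
      ((volume.restrict (Ioc (0 : ℝ) 1)).prod (volume.restrict (Ioc (0 : ℝ) 1))) := by
    have e : (Function.uncurry fun x t : ℝ => (Ici t).indicator
        (fun x => ENNReal.ofReal |f' t| * ENNReal.ofReal (g x)) x)
        = {p : ℝ × ℝ | p.2 ≤ p.1}.indicator
          fun p => ENNReal.ofReal |f' p.2| * ENNReal.ofReal (g p.1) := by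
      ext ⟨x, t⟩
      simp [Function.uncurry, indicator]
    rw [e]
    refine AEMeasurable.indicator ?_ (measurableSet_le measurable_snd measurable_fst)
    exact (hf'Ioc.aestronglyMeasurable.aemeasurable.comp_snd.abs.ennreal_ofReal).mul
      (hg.aemeasurable measurableSet_Ioc).comp_fst.ennreal_ofReal
  have hle : ∫⁻ x in Ioc (0 : ℝ) 1, ENNReal.ofReal (|f x| * g x)
      ≤ ENNReal.ofReal (∫ t in Ioc (0 : ℝ) 1, |f' t| * h t) := by
    rw [ofReal_integral_eq_lintegral_ofReal hint hnn']
    calc _ ≤ ∫⁻ x in Ioc (0 : ℝ) 1, ∫⁻ t in Ioc (0 : ℝ) 1, (Ici t).indicator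
          (fun x => ENNReal.ofReal |f' t| * ENNReal.ofReal (g x)) x :=
          setLIntegral_mono' measurableSet_Ioc hpoint
      _ = ∫⁻ t in Ioc (0 : ℝ) 1, ∫⁻ x in Ioc (0 : ℝ) 1, (Ici t).indicator
          (fun x => ENNReal.ofReal |f' t| * ENNReal.ofReal (g x)) x :=
          lintegral_lintegral_swap hswapmeas
      _ ≤ _ := setLIntegral_mono' measurableSet_Ioc htail
  refine ⟨⟨hmeas, (hasFiniteIntegral_iff_ofReal hnn).2
    (hle.trans_lt ENNReal.ofReal_lt_top)⟩, ?_⟩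
  rw [integral_eq_lintegral_of_nonneg_ae hnn hmeas]
  exact ENNReal.toReal_le_of_le_ofReal (integral_nonneg_of_ae hnn') hle

/-- Tail bound for the weight of the Bessel–Riccati equation. -/
lemma integral_tail_bessel_weight_le {m ν a lam t : ℝ} (hm : 0 < m) (hν : 0 < ν) (ha : 0 < a)
    (hpos : ∀ s ∈ Ioc 0 a, 0 < besselEntire ν s)
    (hnn : ∀ s ∈ Ioc 0 a, 0 ≤ besselEntire (ν + 1) s)
    (hroot : (1 - 2 * lam + m * ν) * besselEntire ν a - 2 * m * a * besselEntire (ν + 1) a = 0)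
    (ht : t ∈ Ioc (0 : ℝ) 1) :
    ∫ x in t..1, ((1 - ν ^ 2 * m ^ 2) / 4 / x ^ 2 + m ^ 2 * a * x ^ m / x ^ 2)
      ≤ (1 + ν * m) / 2 / t - lam := by
  have hmem : ∀ x ∈ Icc t 1, a * x ^ m ∈ Ioc 0 a := fun x hx => by
    have hx0 : 0 < x := ht.1.trans_le hx.1
    have h1 : x ^ m ≤ 1 := Real.rpow_le_one hx0.le hx.2 hm.le
    exact ⟨mul_pos ha (Real.rpow_pos_of_pos hx0 _), by nlinarith⟩
  set p : ℝ → ℝ := fun y => ((1 + ν * m) / 2 - m * (a * y ^ m * besselEntire (ν + 1) (a * y ^ m)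
        / besselEntire ν (a * y ^ m))) / y with hp
  have hderiv : ∀ x ∈ Icc t 1, HasDerivAt p
      (-((1 - ν ^ 2 * m ^ 2) / 4 / x ^ 2 + m ^ 2 * a * x ^ m / x ^ 2) - p x ^ 2) x := fun x hx =>
    hasDerivAt_riccati hν (ht.1.trans_le hx.1) (hpos _ (hmem x hx)).ne'
  have hgcont : ContinuousOn
      (fun x : ℝ => (1 - ν ^ 2 * m ^ 2) / 4 / x ^ 2 + m ^ 2 * a * x ^ m / x ^ 2) (Icc t 1) := by
    have h2 : ∀ x ∈ Icc t 1, x ^ 2 ≠ 0 := fun x hx => pow_ne_zero 2 (ht.1.trans_le hx.1).ne'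
    exact (continuousOn_const.div (by fun_prop) h2).add
      ((continuousOn_const.mul (Real.continuous_rpow_const hm.le).continuousOn).div
        (by fun_prop) h2)
  have hle := intervalIntegral.integral_le_sub_of_hasDeriv_right_of_le (g := fun x => -p x) ht.2
    (fun x hx => (hderiv x hx).neg.continuousAt.continuousWithinAt)
    (fun x hx => (hderiv x (Ioo_subset_Icc_self hx)).neg.hasDerivWithinAt)
    hgcont.integrableOn_Icc
    (fun x _ => by nlinarith [sq_nonneg (p x)])
  have hp1 : p 1 = lam := by
    have h := (hpos a ⟨ha, le_rfl⟩).ne'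
    simp only [hp, Real.one_rpow, mul_one, div_one]
    field_simp
    linarith
  have hpt : p t ≤ (1 + ν * m) / 2 / t := by
    have hs := hmem t (left_mem_Icc.2 ht.2)
    have : 0 ≤ m * (a * t ^ m * besselEntire (ν + 1) (a * t ^ m) / besselEntire ν (a * t ^ m)) :=
      mul_nonneg hm.le (div_nonneg (mul_nonneg hs.1.le (hnn _ hs)) (hpos _ hs).le)
    have h0 := ht.1.le
    simp only [hp]
    gcongr
    linarith
  linarith

theorem stmt_3 (m ν lam c jν : ℝ) (f f' : ℝ → ℝ)
    (hm : 0 < m) (hν : ν ∈ Set.Ioc 0 (1 / m))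
    (hlam : lam ≤ 0)
    (hc : 0 < c)
    (hjν_pos : 0 < jν) (hjν_zero : besselJ ν jν = 0)
    (hjν_first : ∀ t ∈ Set.Ioo 0 jν, 0 < besselJ ν t)
    (hcm : 2 * c / m ∈ Set.Ioo 0 jν)
    (hroot : (1 - 2 * lam) * besselJ ν (2 * c / m)
      + 2 * c * deriv (besselJ ν) (2 * c / m) = 0)
    (hf'int : IntegrableOn f' (Set.Icc 0 1))
    (hf : ∀ x ∈ Set.Icc (0:ℝ) 1, f x = ∫ t in (0:ℝ)..x, f' t)
    (hL1 : IntegrableOn (fun x => f' x / x) (Set.Ioc 0 1)) :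
    (1 - ν ^ 2 * m ^ 2) / 4 * (∫ x in Set.Ioc (0:ℝ) 1, |f x| / x ^ 2)
      + c ^ 2 * (∫ x in Set.Ioc (0:ℝ) 1, |f x| / x ^ ((2:ℝ) - m))
    ≤ ∫ x in Set.Ioc (0:ℝ) 1, |f' x| / x * ((1 + ν * m) / 2 - lam * x) := by
  obtain ⟨hν0, hν1⟩ := hν
  have hνm : ν * m ≤ 1 := (le_div_iff₀ hm).1 hν1
  have hνm0 : 0 < ν * m := mul_pos hν0 hm
  have hA : 0 ≤ (1 - ν ^ 2 * m ^ 2) / 4 := by nlinarith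
  set a : ℝ := (c / m) ^ 2 with ha
  have ha0 : 0 < a := by positivity
  have hma : m ^ 2 * a = c ^ 2 := by rw [ha]; field_simp
  have hxa : (2 * c / m) ^ 2 / 4 = a := by rw [ha]; ring
  have hpos : ∀ s ∈ Ioo 0 (jν ^ 2 / 4), 0 < besselEntire ν s := by
    intro s hs
    have hx : 0 < 2 * √s := mul_pos two_pos (Real.sqrt_pos.2 hs.1)
    have hsq : (2 * √s) ^ 2 / 4 = s := by rw [mul_pow, Real.sq_sqrt hs.1.le]; ring
    have h := hjν_first (2 * √s) ⟨hx, lt_of_pow_lt_pow_left₀ 2 hjν_pos.le (by linarith [hs.2])⟩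
    rw [besselJ_eq hx, hsq] at h
    exact pos_of_mul_pos_right h (by positivity)
  have haS : a < jν ^ 2 / 4 := by
    rw [← hxa]
    have := pow_lt_pow_left₀ hcm.2 hcm.1.le two_ne_zero
    linarith
  have hsub : Ioc 0 a ⊆ Ioo 0 (jν ^ 2 / 4) := fun s hs => ⟨hs.1, hs.2.trans_lt haS⟩
  have hroot' : (1 - 2 * lam + m * ν) * besselEntire ν a
      - 2 * m * a * besselEntire (ν + 1) a = 0 := by
    rw [(hasDerivAt_besselJ hν0 hcm.1).deriv, besselJ_eq hcm.1, hxa] at hroot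
    have hpw : (2 * c / m / 2) ^ ν ≠ 0 := (Real.rpow_pos_of_pos (half_pos hcm.1) _).ne'
    refine (mul_eq_zero.1 (?_ : (2 * c / m / 2) ^ ν * _ = 0)).resolve_left hpw
    rw [← hroot, ha]
    field_simp
    ring
  have h2 : ∀ x ∈ Ioc (0 : ℝ) 1, x ^ 2 ≠ 0 := fun x hx => pow_ne_zero 2 hx.1.ne'
  have hg1 : ContinuousOn (fun x : ℝ => (1 - ν ^ 2 * m ^ 2) / 4 / x ^ 2) (Ioc 0 1) :=
    continuousOn_const.div (by fun_prop) h2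
  have hg2 : ContinuousOn (fun x : ℝ => m ^ 2 * a * x ^ m / x ^ 2) (Ioc 0 1) :=
    (continuousOn_const.mul (Real.continuous_rpow_const hm.le).continuousOn).div (by fun_prop) h2
  have hg1nn : ∀ x ∈ Ioc (0 : ℝ) 1, 0 ≤ (1 - ν ^ 2 * m ^ 2) / 4 / x ^ 2 :=
    fun x _ => div_nonneg hA (sq_nonneg x)
  have hg2nn : ∀ x ∈ Ioc (0 : ℝ) 1, 0 ≤ m ^ 2 * a * x ^ m / x ^ 2 := fun x hx => by
    have := hx.1
    positivity
  have hRHS : ∀ x ∈ Ioc (0 : ℝ) 1, |f' x| * ((1 + ν * m) / 2 / x - lam)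
      = |f' x| / x * ((1 + ν * m) / 2 - lam * x) := fun x hx => by
    have := hx.1.ne'
    field_simp
  have hint : IntegrableOn (fun x => |f' x| * ((1 + ν * m) / 2 / x - lam)) (Ioc 0 1) := by
    have h := (hL1.abs.const_mul ((1 + ν * m) / 2)).sub
      ((hf'int.mono_set Ioc_subset_Icc_self).abs.const_mul lam)
    refine IntegrableOn.congr_fun h (fun x hx => ?_) measurableSet_Ioc
    simp only [Pi.sub_apply, abs_div, abs_of_pos hx.1]
    ring
  obtain ⟨hI, hle⟩ := integral_abs_primitive_mul_le hf'int hf (hg1.add hg2)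
    (fun x hx => add_nonneg (hg1nn x hx) (hg2nn x hx))
    (fun t ht => by
      have := div_pos (by linarith : 0 < (1 + ν * m) / 2) ht.1
      linarith)
    (fun t ht => integral_tail_bessel_weight_le hm hν0 ha0 (fun s hs => hpos s (hsub hs))
      (fun s hs => besselEntire_add_one_nonneg hν0 hpos (hsub hs)) hroot' ht) hint
  rw [setIntegral_congr_fun measurableSet_Ioc hRHS] at hle
  refine le_trans (le_of_eq ?_) hle
  have hfc : ContinuousOn f (Ioc 0 1) :=
    continuousOn_of_eq_primitive hf'int hf
  have hI1 : IntegrableOn (fun x => |f x| * ((1 - ν ^ 2 * m ^ 2) / 4 / x ^ 2)) (Ioc 0 1) := by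
    refine Integrable.mono' hI ((hfc.abs.mul hg1).aestronglyMeasurable measurableSet_Ioc)
      ((ae_restrict_iff' measurableSet_Ioc).2 (ae_of_all _ fun x hx => ?_))
    rw [Real.norm_of_nonneg (mul_nonneg (abs_nonneg _) (hg1nn x hx))]
    exact mul_le_mul_of_nonneg_left (le_add_of_nonneg_right (hg2nn x hx)) (abs_nonneg _)
  have hI2 : IntegrableOn (fun x => |f x| * (m ^ 2 * a * x ^ m / x ^ 2)) (Ioc 0 1) := by
    refine Integrable.mono' hI ((hfc.abs.mul hg2).aestronglyMeasurable measurableSet_Ioc)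
      ((ae_restrict_iff' measurableSet_Ioc).2 (ae_of_all _ fun x hx => ?_))
    rw [Real.norm_of_nonneg (mul_nonneg (abs_nonneg _) (hg2nn x hx))]
    exact mul_le_mul_of_nonneg_left (le_add_of_nonneg_left (hg1nn x hx)) (abs_nonneg _)
  simp only [Pi.add_apply, mul_add]
  rw [integral_add hI1 hI2, ← integral_const_mul, ← integral_const_mul]
  congr 1
  · exact setIntegral_congr_fun measurableSet_Ioc fun x _ => by ring
  · refine setIntegral_congr_fun measurableSet_Ioc fun x hx => ?_
    have := Real.rpow_pos_of_pos hx.1 m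
    have := hx.1
    simp only [hma, Real.rpow_sub hx.1, Real.rpow_two]
    field_simp
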